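/- arXiv:0807.1648 — 4 statements merged into one kernel-verified Lean document; each statement's English description precedes it below -/
import Mathlib

section
/- Let K ⊂ ℂ be a compact set, U = ℂ ∖ K, and let H : U → {z ∈ ℂ : |z| > 1} be a holomorphic bijection with |H(z)| → ∞ as |z| → ∞. Then there exist a nonzero constant β ∈ ℂ and a bounded holomorphic function h : U → ℂ such that H(z) = βz + h(z) for all z ∈ U, and moreover there exist constants C, R > 0 such that |h'(z)| ≤ C/|z|² whenever z ∈ U and |z| ≥ R. -/
open MeasureTheory Metric Set Filter

open scoped Topology

open Bornology (cobounded)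

/-- A holomorphic function that is injective near a point has nonzero derivative there. -/
theorem AnalyticAt.deriv_ne_zero_of_injOn {f : ℂ → ℂ} {c : ℂ} {s : Set ℂ}
    (hf : AnalyticAt ℂ f c) (hs : s ∈ 𝓝 c) (inj : InjOn f s) : deriv f c ≠ 0 := by
  intro hd
  have hne : ¬ ∀ᶠ z in 𝓝 c, f z - f c = 0 := by
    intro h
    have h' : ∀ᶠ z in 𝓝[≠] c, z = c := by
      filter_upwards [nhdsWithin_le_nhds h, nhdsWithin_le_nhds hs] with z hz hzs
      exact inj hzs (mem_of_mem_nhds hs) (sub_eq_zero.1 hz)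
    obtain ⟨z, hz, hzc⟩ := (h'.and self_mem_nhdsWithin).exists
    exact hzc hz
  obtain ⟨n, k, hk, hk0, hfk⟩ :=
    (AnalyticAt.exists_eventuallyEq_pow_smul_nonzero_iff (hf.sub analyticAt_const)).2 hne
  have hn0 : n ≠ 0 := by
    rintro rfl
    have := hfk.self_of_nhds
    simp at this
    exact hk0 this.symm
  have hn1 : n ≠ 1 := by
    rintro rfl
    have h1 : deriv (fun z => f z - f c) c = deriv (fun z => (z - c) ^ 1 • k z) c :=
      Filter.EventuallyEq.deriv_eq hfk
    have h2 : HasDerivAt (fun z => (z - c) ^ 1 • k z) (k c) c := by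
      have h3 := ((hasDerivAt_id c).sub_const c).mul hk.differentiableAt.hasDerivAt
      simp only [id, sub_self, one_mul, zero_mul, add_zero] at h3
      simp only [pow_one, smul_eq_mul]
      exact h3
    rw [h2.deriv, deriv_sub_const, hd] at h1
    exact hk0 h1.symm
  set φ : ℂ → ℂ := fun z => (z - c) * (k z / k c) ^ ((n : ℂ)⁻¹) with hφ
  have hφa : AnalyticAt ℂ φ c := by
    refine (analyticAt_id.sub analyticAt_const).mul
      ((hk.div analyticAt_const hk0).cpow analyticAt_const ?_)
    simp [hk0]
  have hpow : ∀ z, φ z ^ n = (z - c) ^ n * (k z / k c) := by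
    intro z
    rw [hφ]
    simp only
    rw [mul_pow, Complex.cpow_nat_inv_pow _ hn0]
  have hφc : φ c = 0 := by simp [hφ]
  have hfφ : ∀ᶠ z in 𝓝 c, f z - f c = k c * φ z ^ n := by
    filter_upwards [hfk] with z hz
    refine hz.trans ?_
    rw [hpow, smul_eq_mul]
    field_simp
  rcases hφa.eventually_constant_or_nhds_le_map_nhds with h | h
  · apply hne
    filter_upwards [h, hfφ] with z hz hz'
    rw [hz', hz, hφc, zero_pow hn0, mul_zero]
  · rw [hφc] at h
    obtain ⟨ω, hω⟩ : ∃ ω : ℂ, IsPrimitiveRoot ω n :=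
      ⟨_, Complex.isPrimitiveRoot_exp n hn0⟩
    have hT : φ '' {z | z ∈ s ∧ f z - f c = k c * φ z ^ n} ∈ 𝓝 0 :=
      h (image_mem_map (Filter.inter_mem hs hfφ))
    have hT' : ∀ᶠ w in 𝓝 (0 : ℂ), ω * w ∈ φ '' {z | z ∈ s ∧ f z - f c = k c * φ z ^ n} := by
      have : Tendsto (fun w : ℂ => ω * w) (𝓝 0) (𝓝 0) := by
        simpa using (continuous_const_mul ω).tendsto 0
      exact this hT
    have hev : ∀ᶠ w in 𝓝[≠] (0 : ℂ), w ≠ 0 := self_mem_nhdsWithin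
    obtain ⟨w, ⟨⟨a, ⟨has, ha⟩, haw⟩, ⟨b, ⟨hbs, hb⟩, hbw⟩⟩, hw⟩ :=
      (((Filter.Eventually.and hT hT').filter_mono nhdsWithin_le_nhds).and hev).exists
    have hab : f a = f b := by
      rw [haw] at ha
      rw [hbw, mul_pow, hω.pow_eq_one, one_mul] at hb
      exact sub_left_injective (ha.trans hb.symm)
    have := inj has hbs hab
    rw [← this, haw] at hbw
    have h1 : ω = 1 := by
      have : (ω - 1) * w = 0 := by linear_combination -hbw
      exact sub_eq_zero.1 ((mul_eq_zero.1 this).resolve_right hw)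
    exact hn1 (by simpa [h1] using hω.eq_orderOf)

theorem exists_setOf_lt_norm_subset {s : Set ℂ} (hs : s ∈ cobounded ℂ) :
    ∃ R : ℝ, ∀ z : ℂ, R < ‖z‖ → z ∈ s := by
  obtain ⟨R, -, hR⟩ := (hasBasis_cobounded_compl_closedBall (0 : ℂ)).mem_iff.1 hs
  exact ⟨R, fun z hz => hR (by simpa using hz)⟩

/-- The germ at `0` of `f` read in the coordinate `z⁻¹` on both sides, sending `0` to `0`. -/
noncomputable def germAtInfty (f : ℂ → ℂ) : ℂ → ℂ :=
  Function.update (fun z => (f z⁻¹)⁻¹) 0 0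

theorem germAtInfty_zero (f : ℂ → ℂ) : germAtInfty f 0 = 0 := by
  simp [germAtInfty]

theorem germAtInfty_of_ne {f : ℂ → ℂ} {z : ℂ} (hz : z ≠ 0) :
    germAtInfty f z = (f z⁻¹)⁻¹ := by
  simp [germAtInfty, hz]

theorem analyticAt_germAtInfty {f : ℂ → ℂ} {s : Set ℂ} (hso : IsOpen s)
    (hs : s ∈ cobounded ℂ) (hf : DifferentiableOn ℂ f s)
    (hlim : Tendsto f (cobounded ℂ) (cobounded ℂ)) : AnalyticAt ℂ (germAtInfty f) 0 := by
  apply Complex.analyticAt_of_differentiable_on_punctured_nhds_of_continuousAt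
  · have h0 : ∀ᶠ w in cobounded ℂ, f w ≠ 0 := hlim.eventually_ne_cobounded 0
    filter_upwards [tendsto_inv₀_nhdsNE_zero.eventually hs,
      tendsto_inv₀_nhdsNE_zero.eventually h0, self_mem_nhdsWithin] with z hz hz0 hzn
    have hd : DifferentiableAt ℂ (fun z => (f z⁻¹)⁻¹) z :=
      ((hf.differentiableAt (hso.mem_nhds hz)).comp z (differentiableAt_inv hzn)).inv hz0
    refine hd.congr_of_eventuallyEq ?_
    filter_upwards [isOpen_ne.mem_nhds hzn] with w hw
    exact germAtInfty_of_ne hw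
  · rw [germAtInfty, continuousAt_update_same]
    exact tendsto_inv₀_cobounded.comp (hlim.comp tendsto_inv₀_nhdsNE_zero)

theorem injOn_germAtInfty {f : ℂ → ℂ} {s : Set ℂ} (inj : InjOn f s) (h0 : ∀ z ∈ s, f z ≠ 0) :
    InjOn (germAtInfty f) {z | z = 0 ∨ z⁻¹ ∈ s} := by
  intro a ha b hb hab
  rcases eq_or_ne a 0 with rfl | ha0 <;> rcases eq_or_ne b 0 with rfl | hb0
  · rfl
  · rw [germAtInfty_zero, germAtInfty_of_ne hb0, zero_eq_inv] at hab
    exact absurd hab.symm (h0 _ (hb.resolve_left hb0))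
  · rw [germAtInfty_zero, germAtInfty_of_ne ha0, inv_eq_zero] at hab
    exact absurd hab (h0 _ (ha.resolve_left ha0))
  · rw [germAtInfty_of_ne ha0, germAtInfty_of_ne hb0, inv_inj] at hab
    exact inv_injective (inj (ha.resolve_left ha0) (hb.resolve_left hb0) hab)

theorem setOf_eq_zero_or_inv_mem_mem_nhds {s : Set ℂ} (hs : s ∈ cobounded ℂ) :
    {z : ℂ | z = 0 ∨ z⁻¹ ∈ s} ∈ 𝓝 0 := by
  have h := eventually_nhdsWithin_iff.1 (tendsto_inv₀_nhdsNE_zero.eventually hs)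
  filter_upwards [h] with z hz
  exact or_iff_not_imp_left.2 hz

/-- If the germ at infinity is holomorphic with nonzero derivative, then `f` is open at infinity. -/
theorem image_mem_cobounded {f : ℂ → ℂ} {t : Set ℂ} (ha : AnalyticAt ℂ (germAtInfty f) 0)
    (hd : deriv (germAtInfty f) 0 ≠ 0) (ht : t ∈ cobounded ℂ) : f '' t ∈ cobounded ℂ := by
  have hopen : 𝓝 0 ≤ map (germAtInfty f) (𝓝 0) := by
    rcases ha.eventually_constant_or_nhds_le_map_nhds with h | h
    · exact absurd ((EventuallyEq.deriv_eq h).trans (deriv_const _ _)) hd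
    · rwa [germAtInfty_zero] at h
  have hT := hopen (image_mem_map (setOf_eq_zero_or_inv_mem_mem_nhds ht))
  filter_upwards [tendsto_inv₀_cobounded.eventually hT,
    tendsto_id.eventually_ne_cobounded (0 : ℂ)] with w hw hw0
  obtain ⟨z, hz, hzw⟩ := hw
  rcases eq_or_ne z 0 with rfl | hz0
  · rw [germAtInfty_zero, zero_eq_inv] at hzw
    exact absurd hzw.symm hw0
  · rw [germAtInfty_of_ne hz0, inv_inj] at hzw
    exact ⟨z⁻¹, hz.resolve_left hz0, hzw⟩

/-- If the germ at infinity is holomorphic with nonzero derivative, then `f` is asymptotically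
affine, with a remainder holomorphic at infinity. -/
theorem exists_eventually_eq_mul_add {f : ℂ → ℂ} (ha : AnalyticAt ℂ (germAtInfty f) 0)
    (hd : deriv (germAtInfty f) 0 ≠ 0) :
    ∃ (β : ℂ) (n : ℂ → ℂ), β ≠ 0 ∧ AnalyticAt ℂ n 0 ∧
      ∀ᶠ z in cobounded ℂ, f z = β * z + n z⁻¹ := by
  have analyticAt_dslope {g : ℂ → ℂ} (hg : AnalyticAt ℂ g 0) : AnalyticAt ℂ (dslope g 0) 0 := by
    obtain ⟨p, hp⟩ := hg
    exact ⟨_, hp.has_fpower_series_dslope_fslope⟩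
  have hk := analyticAt_dslope ha
  have hk0 : dslope (germAtInfty f) 0 0 ≠ 0 := by rwa [dslope_same]
  have hm := hk.inv hk0
  refine ⟨(dslope (germAtInfty f) 0 0)⁻¹, dslope (dslope (germAtInfty f) 0)⁻¹ 0,
    inv_ne_zero hk0, analyticAt_dslope hm, ?_⟩
  filter_upwards [tendsto_id.eventually_ne_cobounded (0 : ℂ)] with z (hz : z ≠ 0)
  have hz' : z⁻¹ ≠ 0 := inv_ne_zero hz
  rw [dslope_of_ne _ hz', slope_def_field, Pi.inv_apply, Pi.inv_apply, dslope_of_ne _ hz',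
    slope_def_field, germAtInfty_zero, germAtInfty_of_ne hz', inv_inv]
  simp only [sub_zero, div_inv_eq_mul]
  field_simp
  ring

/-- A holomorphic bijection `H` from the complement of a compact set onto the
exterior of the unit disk with `|H(z)| → ∞` as `|z| → ∞` has the form `H(z) = βz + h(z)` with
`β ≠ 0` and `h` bounded holomorphic, and `|h'(z)| ≤ C/|z|²` for `|z|` large. -/
theorem exterior_biholomorphism_affine_plus_bounded
    (K : Set ℂ) (hK : IsCompact K)
    (H : ℂ → ℂ)
    (hol : DifferentiableOn ℂ H Kᶜ)
    (bij : Set.BijOn H Kᶜ {z : ℂ | 1 < ‖z‖})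
    (hinf : ∀ M : ℝ, ∃ R : ℝ, ∀ z : ℂ, R ≤ ‖z‖ → M ≤ ‖H z‖) :
    ∃ (β : ℂ) (h : ℂ → ℂ),
      β ≠ 0 ∧
      DifferentiableOn ℂ h Kᶜ ∧
      (∃ M : ℝ, ∀ z ∈ Kᶜ, ‖h z‖ ≤ M) ∧
      (∀ z ∈ Kᶜ, H z = β * z + h z) ∧
      (∃ C R : ℝ, 0 < C ∧ 0 < R ∧
        ∀ z ∈ Kᶜ, R ≤ ‖z‖ → ‖deriv h z‖ ≤ C / ‖z‖ ^ 2) := by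
  have hKc : Kᶜ ∈ cobounded ℂ := Bornology.isBounded_def.1 hK.isBounded
  have hlim : Tendsto H (cobounded ℂ) (cobounded ℂ) := by
    rw [← tendsto_norm_atTop_iff_cobounded, Filter.tendsto_atTop]
    intro M
    obtain ⟨R, hR⟩ := hinf M
    filter_upwards [tendsto_norm_cobounded_atTop.eventually_ge_atTop R] with z hz
    exact hR z hz
  have hH0 : ∀ z ∈ Kᶜ, H z ≠ 0 := by
    intro z hz h
    have := bij.mapsTo hz
    simp only [mem_ofPred_eq, h, norm_zero] at this
    linarith
  have ha := analyticAt_germAtInfty hK.isClosed.isOpen_compl hKc hol hlim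
  have hd := ha.deriv_ne_zero_of_injOn (setOf_eq_zero_or_inv_mem_mem_nhds hKc)
    (injOn_germAtInfty bij.injOn hH0)
  obtain ⟨β, n, hβ, hn, hHn⟩ := exists_eventually_eq_mul_add ha hd
  have hinv : Tendsto (fun z : ℂ => z⁻¹) (cobounded ℂ) (𝓝 0) := tendsto_inv₀_cobounded
  have hnb : ∀ᶠ z in cobounded ℂ, ‖n z⁻¹‖ ≤ ‖n 0‖ + 1 :=
    hinv.eventually ((hn.continuousAt.norm.eventually_lt_const (lt_add_one _)).mono
      fun _ h => h.le)
  have hndb : ∀ᶠ z in cobounded ℂ, ‖deriv n z⁻¹‖ ≤ ‖deriv n 0‖ + 1 :=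
    hinv.eventually ((hn.deriv.continuousAt.norm.eventually_lt_const (lt_add_one _)).mono
      fun _ h => h.le)
  have hnd : ∀ᶠ z in cobounded ℂ, DifferentiableAt ℂ n z⁻¹ :=
    hinv.eventually (hn.eventually_analyticAt.mono fun _ h => h.differentiableAt)
  obtain ⟨R, hR⟩ := exists_setOf_lt_norm_subset
    (hHn.and (hnb.and (hndb.and (hnd.and hKc))))
  have ht : {z : ℂ | R < ‖z‖} ∈ cobounded ℂ :=
    tendsto_norm_cobounded_atTop.eventually_gt_atTop R
  obtain ⟨M, hM⟩ := exists_setOf_lt_norm_subset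
    (image_mem_cobounded ha hd ht)
  refine ⟨β, fun z => H z - β * z, hβ, hol.sub (by fun_prop), ?_, fun z _ => by ring, ?_⟩
  · refine ⟨max (‖n 0‖ + 1) (M + ‖β‖ * R), fun z hz => ?_⟩
    beta_reduce
    rcases lt_or_ge R ‖z‖ with hzR | hzR
    · obtain ⟨h1, h2, -⟩ := hR z hzR
      rw [h1, add_sub_cancel_left]
      exact h2.trans (le_max_left _ _)
    · have hHM : ‖H z‖ ≤ M := by
        by_contra! h
        obtain ⟨w, hw, hwz⟩ := hM _ h
        rw [bij.injOn (hR w hw).2.2.2.2 hz hwz] at hw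
        exact absurd hw (not_lt.2 hzR)
      refine le_trans ?_ (le_max_right _ _)
      calc ‖H z - β * z‖ ≤ ‖H z‖ + ‖β * z‖ := norm_sub_le _ _
        _ ≤ M + ‖β‖ * R := by
          rw [norm_mul]
          gcongr
  · refine ⟨‖deriv n 0‖ + 1, max R 0 + 1, by positivity, by positivity, fun z _ hz => ?_⟩
    have hzR : R < ‖z‖ := by linarith [le_max_left R 0]
    have hz0 : z ≠ 0 := norm_pos_iff.1 (by linarith [le_max_right R 0])
    obtain ⟨-, -, h3, h4, -⟩ := hR z hzR
    have heq : (fun z => H z - β * z) =ᶠ[𝓝 z] fun z => n z⁻¹ := by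
      filter_upwards [continuous_norm.continuousAt.eventually_const_lt hzR] with w hw
      rw [(hR w hw).1, add_sub_cancel_left]
    have hder : HasDerivAt (fun z => n z⁻¹) (deriv n z⁻¹ * -(z ^ 2)⁻¹) z :=
      h4.hasDerivAt.comp z (hasDerivAt_inv hz0)
    rw [heq.deriv_eq, hder.deriv, norm_mul, norm_neg, norm_inv, norm_pow, ← div_eq_mul_inv]
    gcongr
end

section
/- Let R₀ > 0, let K be a compact subset of the open ball B(0,R₀), U = ℝ² ∖ K, and let T : U → ℂ be an injective holomorphic map with |T(z)| ≥ 1 for all z ∈ U, of the form T(z) = βz + h(z) with β ∈ ℂ ∖ {0} and h : U → ℂ bounded holomorphic; assume |DT(x)| ≤ C₀ for all x ∈ U with |x| ≥ R₀. Then there exist constants R ≥ R₀ and C > 0, depending only on β, sup_U |h|, C₀ and R₀, such that the vector field H_T(x) = (1/(2π)) DT(x)^T (T(x)^⊥/|T(x)|²) satisfies |H_T(x)| ≤ C/|x| for all x with |x| ≥ R. -/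
open MeasureTheory Metric Set Filter

noncomputable section

/-- counterclockwise rotation of a vector of ℝ² ≃ ℂ by a right angle: `(x₁,x₂) ↦ (-x₂,x₁)` -/
def perp (v : ℂ) : ℂ := Complex.I * v

/-- the real (euclidean) dot product on ℝ² ≃ ℂ -/
def dotR (a b : ℂ) : ℝ := a.re * b.re + a.im * b.im

/-- the transpose of a real-linear map of ℝ² ≃ ℂ, applied to a vector `w` -/
def transApply (L : ℂ →L[ℝ] ℂ) (w : ℂ) : ℂ :=
  (dotR (L 1) w : ℂ) + (dotR (L Complex.I) w : ℂ) * Complex.I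

/-- the harmonic vector field `H_T(x) = (1/2π) DT(x)^T (T(x)^⊥ / |T(x)|²)` -/
def HT (T : ℂ → ℂ) (x : ℂ) : ℂ :=
  (1 / (2 * Real.pi)) • transApply (fderiv ℝ T x) ((‖T x‖ ^ 2)⁻¹ • perp (T x))

/-- `T(y)* = T(y)/|T(y)|²` -/
def starT (T : ℂ → ℂ) (y : ℂ) : ℂ := (‖T y‖ ^ 2)⁻¹ • T y

/-- the Biot–Savart-type operator
`K_T[ω](x) = (1/2π) DT(x)^T ∫ ((T(x)−T(y))^⊥/|T(x)−T(y)|² − (T(x)−T(y)*)^⊥/|T(x)−T(y)*|²) ω(y) dy` -/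
def KT (T : ℂ → ℂ) (ω : ℂ → ℝ) (x : ℂ) : ℂ :=
  (1 / (2 * Real.pi)) • transApply (fderiv ℝ T x)
    (∫ y : ℂ, ω y • ((‖T x - T y‖ ^ 2)⁻¹ • perp (T x - T y)
      - (‖T x - starT T y‖ ^ 2)⁻¹ • perp (T x - starT T y)))

theorem abs_dotR_le (a b : ℂ) : |dotR a b| ≤ ‖a‖ * ‖b‖ := by
  have h : dotR a b = (a * (starRingEnd ℂ) b).re := by simp [dotR]
  rw [h]
  exact (Complex.abs_re_le_norm _).trans_eq (by simp)

theorem norm_transApply_le (L : ℂ →L[ℝ] ℂ) (w : ℂ) : ‖transApply L w‖ ≤ 2 * (‖L‖ * ‖w‖) := by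
  have hb : ∀ v : ℂ, ‖v‖ = 1 → |dotR (L v) w| ≤ ‖L‖ * ‖w‖ := fun v hv =>
    (abs_dotR_le _ _).trans
      (mul_le_mul_of_nonneg_right (L.unit_le_opNorm v hv.le) (norm_nonneg w))
  have h₁ := hb 1 (by simp)
  have hI := hb Complex.I (by simp)
  refine (norm_add_le _ _).trans ?_
  rw [norm_mul, Complex.norm_I, mul_one, Complex.norm_real, Complex.norm_real,
    Real.norm_eq_abs, Real.norm_eq_abs]
  linarith

theorem norm_HT_le (T : ℂ → ℂ) (x : ℂ) : ‖HT T x‖ ≤ ‖fderiv ℝ T x‖ * ‖T x‖⁻¹ := by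
  have hw : ‖(‖T x‖ ^ 2)⁻¹ • perp (T x)‖ = ‖T x‖⁻¹ := by
    rw [perp, norm_smul, norm_mul, Complex.norm_I, one_mul, norm_inv, norm_pow, norm_norm]
    rcases eq_or_ne ‖T x‖ 0 with h0 | h0
    · simp [h0]
    · field_simp
  have h := norm_transApply_le (fderiv ℝ T x) ((‖T x‖ ^ 2)⁻¹ • perp (T x))
  rw [hw] at h
  have hpi : ‖(1 / (2 * Real.pi) : ℝ)‖ ≤ 1 / 2 := by
    rw [Real.norm_of_nonneg (by positivity)]
    exact one_div_le_one_div_of_le two_pos (by linarith [Real.pi_gt_three])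
  rw [HT, norm_smul]
  calc _ ≤ 1 / 2 * (2 * (‖fderiv ℝ T x‖ * ‖T x‖⁻¹)) :=
        mul_le_mul hpi h (norm_nonneg _) (by norm_num)
    _ = _ := by ring

/-- Decay of the harmonic field: under the stated assumptions on `T`,
`|H_T(x)| ≤ C/|x|` for `|x| ≥ R`, with `R ≥ R₀` and `C > 0` depending only on
`β`, the bound `M` on `h`, `C₀` and `R₀`. -/
theorem harmonic_field_decay
    (R₀ C₀ M : ℝ) (β : ℂ)
    (hR₀ : 0 < R₀) (hC₀ : 0 < C₀) (hM : 0 ≤ M) (hβ : β ≠ 0) :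
    ∃ R C : ℝ, R₀ ≤ R ∧ 0 < C ∧
      ∀ (K : Set ℂ) (T h : ℂ → ℂ),
        IsCompact K → K ⊆ Metric.ball 0 R₀ →
        Set.InjOn T Kᶜ →
        DifferentiableOn ℂ T Kᶜ →
        (∀ z ∈ Kᶜ, 1 ≤ ‖T z‖) →
        DifferentiableOn ℂ h Kᶜ →
        (∀ z ∈ Kᶜ, ‖h z‖ ≤ M) →
        (∀ z ∈ Kᶜ, T z = β * z + h z) →
        (∀ x ∈ Kᶜ, R₀ ≤ ‖x‖ → ‖fderiv ℝ T x‖ ≤ C₀) →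
        ∀ x : ℂ, R ≤ ‖x‖ → ‖HT T x‖ ≤ C / ‖x‖ := by
  have hβ' : 0 < ‖β‖ := norm_pos_iff.mpr hβ
  refine ⟨max R₀ (2 * M / ‖β‖), 2 * C₀ / ‖β‖, le_max_left _ _, by positivity, ?_⟩
  intro K T h _ hK _ _ _ _ hh hT hD x hx
  have hxR : R₀ ≤ ‖x‖ := (le_max_left _ _).trans hx
  have hxM : 2 * M ≤ ‖x‖ * ‖β‖ := (div_le_iff₀ hβ').mp ((le_max_right _ _).trans hx)
  have hx0 : 0 < ‖x‖ := hR₀.trans_le hxR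
  have hxK : x ∈ Kᶜ := fun hxK => (mem_ball_zero_iff.mp (hK hxK)).not_ge hxR
  have hlow : ‖β‖ * ‖x‖ / 2 ≤ ‖T x‖ := by
    have htri := norm_sub_le_norm_add (β * x) (h x)
    rw [norm_mul, ← hT x hxK] at htri
    linarith [hh x hxK]
  calc ‖HT T x‖ ≤ ‖fderiv ℝ T x‖ * ‖T x‖⁻¹ := norm_HT_le T x
    _ ≤ C₀ * (‖β‖ * ‖x‖ / 2)⁻¹ :=
        mul_le_mul (hD x hxK hxR) (inv_anti₀ (by positivity) hlow) (by positivity) hC₀.le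
    _ = 2 * C₀ / ‖β‖ / ‖x‖ := by field_simp

end
end

section
/- Let R₀ > 0, let K be a compact subset of the open ball B(0,R₀), U = ℝ² ∖ K, and let T : U → ℂ be an injective holomorphic map with |T(z)| ≥ 1 for all z ∈ U, of the form T(z) = βz + h(z) with β ∈ ℂ ∖ {0} and h : U → ℂ bounded holomorphic; assume |DT(x)| ≤ C₀ and |D²T(x)| ≤ C₀/|x| for all x ∈ U with |x| ≥ R₀. Fix Φ ∈ C^∞(ℝ) non-decreasing with 0 ≤ Φ ≤ 1, Φ(s) = 0 for s ≤ 1 and Φ(s) = 1 for s ≥ 2, and let λ ≥ 2 satisfy λ ≥ |β|R₀ + sup_U |h|. Let α ∈ ℝ and define v(x) = α Φ((|T(x)|−1)/λ) · (1/(2π)) DT(x)^T (T(x)^⊥/|T(x)|²) for x ∈ U, extended by 0 on K. Then there exist constants C, R₁ > 0, depending only on α, β, sup_U |h|, C₀, R₀, λ and Φ, such that the Laplacian Δv (taken componentwise) satisfies |Δv(x)| ≤ C for all x ∈ ℝ² and Δv(x) = 0 whenever |x| ≥ R₁. -/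
open MeasureTheory Metric Set Filter

noncomputable section

/-- the Laplacian of a map `ℝ² ≃ ℂ → ℂ`, taken componentwise:
`Δf(x) = ∂₁₁ f(x) + ∂₂₂ f(x)` -/
def lap (f : ℂ → ℂ) (x : ℂ) : ℂ :=
  fderiv ℝ (fderiv ℝ f) x 1 1 + fderiv ℝ (fderiv ℝ f) x Complex.I Complex.I

/-- The transpose of multiplication by `a` is multiplication by `conj a`. -/
lemma transApply_of_hasDerivAt {T : ℂ → ℂ} {a x : ℂ} (hT : HasDerivAt T a x) (w : ℂ) :
    transApply (fderiv ℝ T x) w = (starRingEnd ℂ) a * w := by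
  rw [(hT.hasFDerivAt.restrictScalars ℝ).fderiv]
  apply Complex.ext <;> simp [transApply, dotR]
  ring

lemma lap_eq_laplacian (f : ℂ → ℂ) (x : ℂ) : lap f x = Laplacian.laplacian f x := by
  simp [lap, InnerProductSpace.laplacian_eq_iteratedFDeriv_complexPlane, iteratedFDeriv_two_apply]

lemma lap_congr {f g : ℂ → ℂ} {x : ℂ} (hfg : f =ᶠ[nhds x] g) : lap f x = lap g x := by
  simp only [lap_eq_laplacian]
  exact (InnerProductSpace.laplacian_congr_nhds hfg).eq_of_nhds

lemma lap_conj_of_analyticAt {g : ℂ → ℂ} {x : ℂ} (hg : AnalyticAt ℂ g x) :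
    lap (fun z => (starRingEnd ℂ) (g z)) x = 0 := by
  have h := congrFun (InnerProductSpace.laplacian_CLE_comp_left (f := g) (l := Complex.conjCLE)) x
  have h0 : Laplacian.laplacian g x = 0 := hg.harmonicAt.2.eq_of_nhds
  rw [lap_eq_laplacian]
  simpa [h0, Function.comp_def] using h

lemma norm_lap_le (f : ℂ → ℂ) (x : ℂ) : ‖lap f x‖ ≤ 2 * ‖iteratedFDeriv ℝ 2 f x‖ := by
  rw [lap_eq_laplacian, InnerProductSpace.laplacian_eq_iteratedFDeriv_complexPlane, two_mul]
  refine (norm_add_le _ _).trans (add_le_add ?_ ?_) <;>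
  · refine (ContinuousMultilinearMap.le_opNorm _ _).trans ?_
    simp [Fin.prod_univ_two]

lemma exists_bound_iteratedFDeriv {E F : Type*} [NormedAddCommGroup E] [NormedSpace ℝ E]
    [ProperSpace E] [NormedAddCommGroup F] [NormedSpace ℝ F] {G : E → F} {n : ℕ}
    (hG : ContDiff ℝ n G) (B : ℝ) :
    ∃ C, 0 < C ∧ ∀ i ≤ n, ∀ p, ‖p‖ ≤ B → ‖iteratedFDeriv ℝ i G p‖ ≤ C := by
  have hex : ∀ i : Fin (n + 1), ∃ C, ∀ p ∈ closedBall (0 : E) B, ‖iteratedFDeriv ℝ i G p‖ ≤ C :=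
    fun i => (isCompact_closedBall _ _).exists_bound_of_continuousOn
      (hG.continuous_iteratedFDeriv (by exact_mod_cast Nat.lt_succ_iff.1 i.2)).continuousOn
  choose C hC using hex
  refine ⟨1 + ∑ i, |C i|, by positivity, fun i hi p hp => ?_⟩
  have h1 := hC ⟨i, Nat.lt_succ_iff.2 hi⟩ p (by simpa using hp)
  have h2 := Finset.single_le_sum (f := fun i => |C i|) (fun _ _ => abs_nonneg _)
    (Finset.mem_univ (⟨i, Nat.lt_succ_iff.2 hi⟩ : Fin (n + 1)))
  have h3 := le_abs_self (C ⟨i, Nat.lt_succ_iff.2 hi⟩)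
  simp only at h1 h2
  linarith

/-- Second derivatives of `G ∘ F` for a bounded holomorphic `F` and a smooth `G`, through Cauchy's
estimates for `F`. -/
lemma norm_iteratedFDeriv_two_comp_le {E F : Type*} [NormedAddCommGroup E] [NormedSpace ℂ E]
    [CompleteSpace E] [NormedAddCommGroup F] [NormedSpace ℝ F] {G : E → F} {f : ℂ → E}
    {U : Set ℂ} {x : ℂ} {r B C : ℝ} (hr : 0 < r) (hB : 1 ≤ B) (hU : IsOpen U)
    (hxU : closedBall x r ⊆ U) (hf : DifferentiableOn ℂ f U) (hG : ContDiff ℝ 2 G)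
    (hfB : ∀ z ∈ closedBall x r, ‖f z‖ ≤ B)
    (hGC : ∀ i ≤ 2, ‖iteratedFDeriv ℝ i G (f x)‖ ≤ C) :
    ‖iteratedFDeriv ℝ 2 (G ∘ f) x‖ ≤ 2 * C * (2 * B / r) ^ 2 := by
  have hx : x ∈ U := hxU (mem_closedBall_self hr.le)
  have hcd : ContDiffOn ℂ 2 f U := hf.contDiffOn hU
  have key := norm_iteratedFDerivWithin_comp_le (𝕜 := ℝ) (g := G) (f := f) (n := 2) (N := 2)
    (s := U) (t := univ) (x := x) (C := C) (D := 2 * B / r) hG.contDiffOn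
    (hcd.restrict_scalars ℝ) le_rfl uniqueDiffOn_univ hU.uniqueDiffOn (mapsTo_univ _ _) hx
    (by simpa [iteratedFDerivWithin_univ] using hGC) ?_
  · rw [iteratedFDerivWithin_of_isOpen 2 hU hx] at key
    simpa using key
  · intro i hi1 hi2
    rw [iteratedFDerivWithin_of_isOpen i hU hx]
    have hfi : ContDiffAt ℂ i f x :=
      (hcd.contDiffAt (hU.mem_nhds hx)).of_le (by exact_mod_cast hi2)
    have hc := Complex.norm_iteratedDeriv_le_of_forall_mem_sphere_norm_le i hr
      (hf.mono (closure_ball_subset_closedBall.trans hxU)).diffContOnCl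
      (fun z hz => hfB z (sphere_subset_closedBall hz))
    rw [← hfi.restrictScalars_iteratedFDeriv (𝕜 := ℝ), Function.comp_apply,
      ContinuousMultilinearMap.norm_restrictScalars, norm_iteratedFDeriv_eq_norm_iteratedDeriv]
    refine hc.trans ?_
    rw [div_pow]
    gcongr
    interval_cases i
    · simp; linarith
    · simp [Nat.factorial]; nlinarith

/-- The cut-off harmonic part at `x`, as a function of the pair `(T x, T' x)`. -/
def cutoffSymbol (α lam : ℝ) (Φ : ℝ → ℝ) (p : ℂ × ℂ) : ℂ :=
  (α * Φ ((‖p.1‖ - 1) / lam)) • ((1 / (2 * Real.pi)) •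
    ((starRingEnd ℂ) p.2 * ((‖p.1‖ ^ 2)⁻¹ • perp p.1)))

lemma cutoffSymbol_eq_zero {α lam : ℝ} {Φ : ℝ → ℝ} (hlam : 0 < lam)
    (hΦ0 : ∀ s : ℝ, s ≤ 1 → Φ s = 0) {p : ℂ × ℂ} (hp : ‖p.1‖ ≤ lam + 1) :
    cutoffSymbol α lam Φ p = 0 := by
  have : (‖p.1‖ - 1) / lam ≤ 1 := by rw [div_le_one hlam]; linarith
  simp [cutoffSymbol, hΦ0 _ this]

lemma contDiff_cutoffSymbol {α lam : ℝ} {Φ : ℝ → ℝ} {n : ℕ} (hlam : 0 < lam)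
    (hΦs : ContDiff ℝ n Φ) (hΦ0 : ∀ s : ℝ, s ≤ 1 → Φ s = 0) :
    ContDiff ℝ n (cutoffSymbol α lam Φ) := by
  rw [contDiff_iff_contDiffAt]
  intro p
  by_cases hp : p.1 = 0
  · refine (contDiffAt_const (c := (0 : ℂ))).congr_of_eventuallyEq ?_
    have hc : ContinuousAt (fun q : ℂ × ℂ => ‖q.1‖) p := by fun_prop
    filter_upwards [hc.eventually_lt (continuousAt_const (y := (1 : ℝ))) (by simp [hp])] with q hq
    exact cutoffSymbol_eq_zero hlam hΦ0 (by linarith)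
  · have hn : ContDiffAt ℝ n (fun q : ℂ × ℂ => ‖q.1‖) p := contDiffAt_fst.norm ℝ hp
    have hconj : ContDiffAt ℝ n (fun q : ℂ × ℂ => (starRingEnd ℂ) q.2) p :=
      Complex.conjCLE.contDiff.contDiffAt.comp p contDiffAt_snd
    have hΦ : ContDiffAt ℝ n (fun q : ℂ × ℂ => Φ ((‖q.1‖ - 1) / lam)) p :=
      hΦs.contDiffAt.comp p ((hn.sub contDiffAt_const).div_const lam)
    have hperp : ContDiffAt ℝ n (fun q : ℂ × ℂ => perp q.1) p :=
      contDiffAt_const.mul contDiffAt_fst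
    have hinv : ContDiffAt ℝ n (fun q : ℂ × ℂ => (‖q.1‖ ^ 2)⁻¹) p :=
      (hn.pow 2).inv (by simpa using hp)
    unfold cutoffSymbol
    fun_prop

/-- The Laplacian of the cut-off harmonic part `v = α Φ((|T|−1)/λ) H_T`
(extended by `0` on `K`) is uniformly bounded and compactly supported, with constants
depending only on `α, β, M = sup|h|, C₀, R₀, λ, Φ` (and not otherwise on `T` or `K`). -/
theorem cutoff_harmonic_part_laplacian_bounded
    (α : ℝ) (β : ℂ) (M C₀ R₀ lam : ℝ) (Φ : ℝ → ℝ)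
    (hβ : β ≠ 0) (hM : 0 ≤ M) (hC₀ : 0 < C₀) (hR₀ : 0 < R₀)
    (hΦs : ContDiff ℝ (⊤ : ℕ∞) Φ) (hΦm : Monotone Φ)
    (hΦ01 : ∀ s : ℝ, 0 ≤ Φ s ∧ Φ s ≤ 1)
    (hΦ0 : ∀ s : ℝ, s ≤ 1 → Φ s = 0) (hΦ1 : ∀ s : ℝ, 2 ≤ s → Φ s = 1)
    (hlam2 : 2 ≤ lam) (hlam : ‖β‖ * R₀ + M ≤ lam) :
    ∃ C R₁ : ℝ, 0 < C ∧ 0 < R₁ ∧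
      ∀ (K : Set ℂ) (T h : ℂ → ℂ),
        IsCompact K → K ⊆ Metric.ball 0 R₀ →
        Set.InjOn T Kᶜ →
        DifferentiableOn ℂ T Kᶜ →
        (∀ z ∈ Kᶜ, 1 ≤ ‖T z‖) →
        DifferentiableOn ℂ h Kᶜ →
        (∀ z ∈ Kᶜ, ‖h z‖ ≤ M) →
        (∀ z ∈ Kᶜ, T z = β * z + h z) →
        (∀ x ∈ Kᶜ, R₀ ≤ ‖x‖ → ‖fderiv ℝ T x‖ ≤ C₀) →
        (∀ x ∈ Kᶜ, R₀ ≤ ‖x‖ → ‖fderiv ℝ (fderiv ℝ T) x‖ ≤ C₀ / ‖x‖) →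
        ∀ v : ℂ → ℂ,
          (∀ x ∈ Kᶜ, v x = (α * Φ ((‖T x‖ - 1) / lam)) • HT T x) →
          (∀ x ∈ K, v x = 0) →
          (∀ x : ℂ, ‖lap v x‖ ≤ C) ∧
          (∀ x : ℂ, R₁ ≤ ‖x‖ → lap v x = 0) := by
  have hb : 0 < ‖β‖ := norm_pos_iff.2 hβ
  have hl : 0 < lam := by linarith
  have hsymb : ContDiff ℝ (2 : ℕ) (cutoffSymbol α lam Φ) :=
    contDiff_cutoffSymbol hl (contDiff_infty.1 hΦs 2) hΦ0
  set r : ℝ := 1 / (2 * ‖β‖) with hr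
  have hr0 : 0 < r := by positivity
  have hbr : ‖β‖ * r = 1 / 2 := by rw [hr]; field_simp
  set R₁ : ℝ := (2 * lam + 2 + M) / ‖β‖ with hR₁
  have hbR₁ : ‖β‖ * R₁ = 2 * lam + 2 + M := by rw [hR₁]; field_simp
  have hR₁0 : 0 < R₁ := by positivity
  set B : ℝ := (2 * lam + 3 + 2 * M) + C₀ with hB
  obtain ⟨C, hC0, hC⟩ := exists_bound_iteratedFDeriv hsymb B
  refine ⟨2 * (2 * C * (2 * B / r) ^ 2), R₁, by positivity, hR₁0, ?_⟩
  intro K T h hK hKR _ hT hT1 _ hhM hTh hDT _ v hv hvK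
  have hKo : IsOpen Kᶜ := hK.isClosed.isOpen_compl
  have hout : ∀ x : ℂ, R₀ ≤ ‖x‖ → x ∈ Kᶜ := fun x hx hxK => by
    have := hKR hxK
    rw [mem_ball_zero_iff] at this
    linarith
  have hTle : ∀ x ∈ Kᶜ, ‖T x‖ ≤ ‖β‖ * ‖x‖ + M := fun x hx => by
    rw [hTh x hx, ← norm_mul]
    exact (norm_add_le _ _).trans (by linarith [hhM x hx])
  have hleT : ∀ x ∈ Kᶜ, ‖β‖ * ‖x‖ - M ≤ ‖T x‖ := fun x hx => by
    have h1 := norm_sub_le (T x) (h x)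
    rw [hTh x hx, add_sub_cancel_right, norm_mul, ← hTh x hx] at h1
    linarith [hhM x hx]
  have hderiv : ∀ x ∈ Kᶜ, HasDerivAt T (deriv T x) x := fun x hx =>
    (hT.differentiableAt (hKo.mem_nhds hx)).hasDerivAt
  have hT' : DifferentiableOn ℂ (deriv T) Kᶜ := hT.deriv hKo
  have hv' : ∀ x ∈ Kᶜ, v x = cutoffSymbol α lam Φ (T x, deriv T x) := fun x hx => by
    rw [hv x hx, HT, transApply_of_hasDerivAt (hderiv x hx), cutoffSymbol]
  have hfar : ∀ x : ℂ, R₁ ≤ ‖x‖ → lap v x = 0 := by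
    intro x hx
    have hev : ∀ᶠ z in nhds x, 2 * lam + 1 + M < ‖β‖ * ‖z‖ :=
      (continuous_const.mul continuous_norm).continuousAt.eventually_const_lt (by
        have := mul_le_mul_of_nonneg_left hx hb.le
        simp only [Pi.mul_apply]
        linarith)
    have hmem : ∀ z : ℂ, 2 * lam + 1 + M < ‖β‖ * ‖z‖ → z ∈ Kᶜ := fun z hz =>
      hout z (le_of_mul_le_mul_left (by linarith) hb)
    have hxK : x ∈ Kᶜ := hmem x hev.self_of_nhds
    have hTx : T x ≠ 0 := norm_pos_iff.1 (zero_lt_one.trans_le (hT1 x hxK))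
    have hg : AnalyticAt ℂ (fun z => ((α / (2 * Real.pi) : ℝ) : ℂ) * -Complex.I *
        (deriv T z / T z)) x :=
      analyticAt_const.mul ((hT'.analyticAt (hKo.mem_nhds hxK)).div
        (hT.analyticAt (hKo.mem_nhds hxK)) hTx)
    rw [← lap_conj_of_analyticAt hg]
    refine lap_congr ?_
    filter_upwards [hev] with z hz
    have hzK := hmem z hz
    have hTz : T z ≠ 0 := norm_pos_iff.1 (zero_lt_one.trans_le (hT1 z hzK))
    have hTz' : (starRingEnd ℂ) (T z) ≠ 0 := by simpa using hTz
    have hΦz : Φ ((‖T z‖ - 1) / lam) = 1 :=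
      hΦ1 _ (by rw [le_div_iff₀ hl]; linarith [hleT z hzK])
    have hπ : (Real.pi : ℂ) ≠ 0 := by exact_mod_cast Real.pi_ne_zero
    rw [hv' z hzK, cutoffSymbol, hΦz]
    simp only [Complex.real_smul, perp]
    push_cast
    rw [← Complex.mul_conj']
    simp only [map_mul, map_div₀, map_neg, Complex.conj_ofReal, Complex.conj_I, map_ofNat]
    field_simp
  refine ⟨fun x => ?_, hfar⟩
  rcases le_total R₁ ‖x‖ with hx | hx
  · rw [hfar x hx, norm_zero]; positivity
  rcases lt_or_ge (‖β‖ * ‖x‖) (‖β‖ * R₀ + 1) with hx0 | hx0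
  · have hev : ∀ᶠ z in nhds x, ‖β‖ * ‖z‖ < ‖β‖ * R₀ + 1 :=
      (continuous_const.mul continuous_norm).continuousAt.eventually_lt_const hx0
    have h0 : v =ᶠ[nhds x] fun _ => 0 := by
      filter_upwards [hev] with z hz
      by_cases hzK : z ∈ K
      · exact hvK z hzK
      · rw [hv' z hzK]
        exact cutoffSymbol_eq_zero hl hΦ0 (by linarith [hTle z hzK])
    rw [lap_congr h0]
    simp only [lap, fderiv_fun_const]
    simp
    positivity
  · have hball : ∀ z ∈ closedBall x r, R₀ ≤ ‖z‖ ∧ ‖z‖ ≤ R₁ + r := fun z hz => by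
      rw [mem_closedBall, dist_eq_norm] at hz
      have h1 := norm_sub_norm_le z x
      have h2 := norm_sub_norm_le x z
      rw [norm_sub_rev] at h2
      exact ⟨le_of_mul_le_mul_left (by nlinarith) hb, by linarith⟩
    have hxK : x ∈ Kᶜ := hout x (hball x (mem_closedBall_self hr0.le)).1
    have hFB : ∀ z ∈ closedBall x r, ‖(T z, deriv T z)‖ ≤ B := fun z hz => by
      have hzK := hout z (hball z hz).1
      have h1 := hTle z hzK
      have h2 := (fderiv ℝ T z).le_opNorm 1
      rw [((hderiv z hzK).hasFDerivAt.restrictScalars ℝ).fderiv] at h2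
      have h3 := hDT z hzK (hball z hz).1
      rw [((hderiv z hzK).hasFDerivAt.restrictScalars ℝ).fderiv] at h3
      have h4 : ‖β‖ * ‖z‖ ≤ ‖β‖ * (R₁ + r) :=
        mul_le_mul_of_nonneg_left (hball z hz).2 hb.le
      simp at h2 h3
      refine max_le ?_ ?_
      · simp only; nlinarith
      · simp only; linarith
    have heq : v =ᶠ[nhds x] cutoffSymbol α lam Φ ∘ fun z => (T z, deriv T z) := by
      filter_upwards [hKo.mem_nhds hxK] with z hz using hv' z hz
    rw [lap_congr heq]
    refine (norm_lap_le _ _).trans (mul_le_mul_of_nonneg_left ?_ zero_le_two)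
    exact norm_iteratedFDeriv_two_comp_le hr0 (by linarith) hKo
      (fun z hz => hout z (hball z hz).1) (hT.prodMk hT') hsymb hFB
      (fun i hi => hC i hi _ (hFB x (mem_closedBall_self hr0.le)))

end
end

section
/- Let Ω ⊆ ℂ be open, T : Ω → ℂ holomorphic with T(x) ≠ 0 for all x ∈ Ω, and φ : ℝ → ℝ continuously differentiable. Then the vector field x ↦ φ(|T(x)|) · H_T(x), where H_T(x) = (1/(2π)) DT(x)^T (T(x)^⊥/|T(x)|²), is divergence free on Ω; in particular H_T(x) · ∇(φ(|T(x)|)) = 0 for every x ∈ Ω. -/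
open MeasureTheory Metric Set Filter

noncomputable section

/-- the divergence `div u = ∂₁ u₁ + ∂₂ u₂` of a vector field on ℝ² ≃ ℂ -/
def divg (u : ℂ → ℂ) (x : ℂ) : ℝ :=
  (fderiv ℝ u x 1).re + (fderiv ℝ u x Complex.I).im

/-- the gradient of a scalar function on ℝ² ≃ ℂ, seen as a vector of ℂ -/
def gradc (g : ℂ → ℝ) (x : ℂ) : ℂ :=
  (↑(fderiv ℝ g x 1) : ℂ) + (↑(fderiv ℝ g x Complex.I) : ℂ) * Complex.I

lemma transApply_of_mul {L : ℂ →L[ℝ] ℂ} {d : ℂ} (hL : ∀ v, L v = d * v) (w : ℂ) :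
    transApply L w = (starRingEnd ℂ) d * w := by
  apply Complex.ext <;> simp [transApply, dotR, hL]
  ring

lemma dotR_gradc (v : ℂ) (g : ℂ → ℝ) (x : ℂ) : dotR v (gradc g x) = fderiv ℝ g x v := by
  have hv : v = v.re • (1 : ℂ) + v.im • Complex.I := by
    apply Complex.ext <;> simp
  conv_rhs => rw [hv, map_add, map_smul, map_smul]
  simp [dotR, gradc]

lemma divg_smul {g : ℂ → ℝ} {u : ℂ → ℂ} {x : ℂ} (hg : DifferentiableAt ℝ g x)
    (hu : DifferentiableAt ℝ u x) :
    divg (fun y => g y • u y) x = g x * divg u x + dotR (u x) (gradc g x) := by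
  simp only [divg, fderiv_fun_smul hg hu]
  simp [dotR, gradc]
  ring

/-- `H_T = (i/2π) conj (T'/T)` wherever `T` is complex differentiable. -/
lemma HT_eq {T : ℂ → ℂ} {x : ℂ} (hT : DifferentiableAt ℂ T x) :
    HT T x = (1 / (2 * Real.pi)) •
      (Complex.I * (starRingEnd ℂ) (deriv T x / T x)) := by
  have hL : ∀ v, fderiv ℝ T x v = deriv T x * v := fun v => by
    rw [hT.hasDerivAt.complexToReal_fderiv.fderiv]
    simp
  rw [HT, transApply_of_mul hL, perp, map_div₀, div_eq_mul_inv ((starRingEnd ℂ) _),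
    Complex.inv_def, Complex.conj_conj, Complex.normSq_conj, Complex.normSq_eq_norm_sq,
    Complex.real_smul (x := (‖T x‖ ^ 2)⁻¹)]
  congr 1
  ring

/-- The field `i conj h` is divergence free when `h` is complex differentiable. -/
lemma differentiableAt_and_divg_smul_I_mul_conj {h : ℂ → ℂ} {x : ℂ} (hh : DifferentiableAt ℂ h x) (c : ℝ) :
    DifferentiableAt ℝ (fun y => c • (Complex.I * (starRingEnd ℂ) (h y))) x ∧
      divg (fun y => c • (Complex.I * (starRingEnd ℂ) (h y))) x = 0 := by
  have h1 := (Complex.conjCLE.hasFDerivAt.comp x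
    hh.hasDerivAt.complexToReal_fderiv).const_mul Complex.I |>.const_smul c
  have h2 : HasFDerivAt (fun y => c • (Complex.I * (starRingEnd ℂ) (h y))) _ x := h1
  refine ⟨h2.differentiableAt, ?_⟩
  rw [divg, h2.fderiv]
  simp

lemma differentiableAt_and_fderiv_comp_norm {T : ℂ → ℂ} {x : ℂ} {φ : ℝ → ℝ} (hT : DifferentiableAt ℂ T x)
    (hx : T x ≠ 0) (hφ : DifferentiableAt ℝ φ ‖T x‖) :
    DifferentiableAt ℝ (fun y => φ ‖T y‖) x ∧
      ∃ c : ℝ, ∀ v, fderiv ℝ (fun y => φ ‖T y‖) x v =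
        c * ((starRingEnd ℂ) (T x) * (deriv T x * v)).re := by
  have hT' := hT.hasDerivAt.complexToReal_fderiv
  have h1 := hT'.norm_sq.sqrt (by positivity)
  simp only [Real.sqrt_sq (norm_nonneg _)] at h1
  have h2 : HasFDerivAt (fun y => φ ‖T y‖) _ x := hφ.hasDerivAt.comp_hasFDerivAt x h1
  refine ⟨h2.differentiableAt, deriv φ ‖T x‖ * (1 / (2 * ‖T x‖)) * 2, fun v => ?_⟩
  rw [h2.fderiv]
  simp [Complex.inner]
  ring

/-- If `T` is holomorphic and nonvanishing on an open set `Ω` and `φ` is `C¹`,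
then `φ(|T|) H_T` is divergence free on `Ω`; in particular `H_T · ∇(φ(|T|)) = 0` on `Ω`. -/
theorem cutoff_harmonic_field_div_free
    (Ω : Set ℂ) (hΩ : IsOpen Ω) (T : ℂ → ℂ) (φ : ℝ → ℝ)
    (hol : DifferentiableOn ℂ T Ω) (hne : ∀ x ∈ Ω, T x ≠ 0)
    (hφ : ContDiff ℝ 1 φ) :
    ∀ x ∈ Ω,
      divg (fun y => φ ‖T y‖ • HT T y) x = 0 ∧
      dotR (HT T x) (gradc (fun y => φ ‖T y‖) x) = 0 := by
  intro x hx
  have hT : DifferentiableAt ℂ T x := hol.differentiableAt (hΩ.mem_nhds hx)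
  have hd : DifferentiableAt ℂ (deriv T) x :=
    (hol.deriv hΩ).differentiableAt (hΩ.mem_nhds hx)
  obtain ⟨hg, c, hc⟩ := differentiableAt_and_fderiv_comp_norm hT (hne x hx)
    ((hφ.differentiable one_ne_zero) ‖T x‖)
  have hev : HT T =ᶠ[nhds x] fun y => (1 / (2 * Real.pi)) •
      (Complex.I * (starRingEnd ℂ) (deriv T y / T y)) := by
    filter_upwards [hΩ.mem_nhds hx] with y hy
    exact HT_eq (hol.differentiableAt (hΩ.mem_nhds hy))
  obtain ⟨hH, hdiv⟩ := differentiableAt_and_divg_smul_I_mul_conj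
    (hd.fun_div hT (hne x hx)) (1 / (2 * Real.pi))
  have hdivHT : divg (HT T) x = 0 := by
    rw [← hdiv, divg, divg, hev.fderiv_eq]
  have horth : dotR (HT T x) (gradc (fun y => φ ‖T y‖) x) = 0 := by
    have hne' : (starRingEnd ℂ) (T x) ≠ 0 := by simpa using hne x hx
    have key : (starRingEnd ℂ) (T x) * (deriv T x * HT T x) =
        ((1 / (2 * Real.pi) * Complex.normSq (deriv T x) : ℝ) : ℂ) * Complex.I := by
      rw [HT_eq hT, map_div₀, Complex.real_smul, Complex.ofReal_mul, ← Complex.mul_conj]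
      field_simp
    rw [dotR_gradc, hc, key, Complex.re_ofReal_mul, Complex.I_re]
    ring
  refine ⟨?_, horth⟩
  rw [divg_smul hg (hH.congr_of_eventuallyEq hev), hdivHT, horth]
  ring

end
end
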